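/- Let Λ be a symbol with odd defect, rank(Λ) = n and Υ(Λ) = [λ; μ], and set n' = n − λ_1 − (def(Λ) − 1)/2. If Λ' is a symbol with (Λ, Λ') ∈ B^+_{n,n'}, then Υ(Λ')^* = μ, Υ(Λ')_* = λ² and def(Λ') = −def(Λ) + 1; in particular Λ' is unique up to equivalence of symbols. -/

import Mathlib

namespace GGP

/-- A *symbol* `Λ = (A; B)`: an ordered pair of finite sets of natural numbers. -/
structure Symbol where
  A : Finset ℕ
  B : Finset ℕ

namespace Symbol

/-- The rank of a symbol:
`rank(Λ) = Σ_{a∈A} a + Σ_{b∈B} b − ⌊((|A|+|B|−1)/2)²⌋ = Σ + Σ − ⌊(|A|+|B|−1)²/4⌋`. -/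
def rank (Λ : Symbol) : ℤ :=
  (∑ a ∈ Λ.A, (a : ℤ)) + (∑ b ∈ Λ.B, (b : ℤ))
    - ((Λ.A.card : ℤ) + (Λ.B.card : ℤ) - 1) ^ 2 / 4

/-- The defect of a symbol: `def(Λ) = |A| − |B| ∈ ℤ`. -/
def defect (Λ : Symbol) : ℤ := (Λ.A.card : ℤ) - (Λ.B.card : ℤ)

/-- The shift of a symbol: `(a_1,…,a_m; b_1,…,b_l) ↦ (a_1+1,…,a_m+1,0; b_1+1,…,b_l+1,0)`. -/
def shift (Λ : Symbol) : Symbol :=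
  ⟨insert 0 (Λ.A.image (· + 1)), insert 0 (Λ.B.image (· + 1))⟩

/-- Equivalence of symbols: one is obtained from the other by finitely many shifts. -/
def Equiv (Λ M : Symbol) : Prop :=
  ∃ k l : ℕ, shift^[k] Λ = shift^[l] M

end Symbol

/-- The partition associated to a finite set `A = {a_1 > … > a_m}` of naturals:
the function sending the index `i` (0-based, so `i` stands for the (i+1)-st part)
to `λ_{i+1} = a_{i+1} − (m − (i+1))`, with parts beyond the length equal to `0`. -/
def upsFun (A : Finset ℕ) : ℕ → ℕ := fun i =>
  if h : i < A.card then
    (A.sort (· ≤ ·))[A.card - 1 - i]'(by rw [Finset.length_sort]; omega)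
      - (A.card - 1 - i)
  else 0

/-- `|λ|`: the sum of the parts of a partition (given as a function). -/
noncomputable def psize (f : ℕ → ℕ) : ℕ := ∑ᶠ i, f i

/-- The transpose of a partition: `(ᵗλ)_{i+1} = #{ j : λ_{j+1} ≥ i+1 }` (0-based index `i`). -/
noncomputable def transposeFun (f : ℕ → ℕ) : ℕ → ℕ := fun i => Set.ncard {j | i + 1 ≤ f j}

/-- `λ ≼ μ` : `μ_i − 1 ≤ λ_i ≤ μ_i` for every `i`. -/
def Prec (f g : ℕ → ℕ) : Prop := ∀ i, g i - 1 ≤ f i ∧ f i ≤ g i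

/-- `λ²`: the partition obtained from `λ` by deleting one copy of its largest part. -/
def tailPart (f : ℕ → ℕ) : ℕ → ℕ := fun i => f (i + 1)

/-- A function `ℕ → ℕ` represents a partition iff it is antitone and eventually zero. -/
def IsPartitionFun (f : ℕ → ℕ) : Prop :=
  Antitone f ∧ ∃ N, ∀ i, N ≤ i → f i = 0

/-- `(Λ, Λ') ∈ B^+_{n,n'}`. -/
def BPlus (n n' : ℕ) (Λ Λ' : Symbol) : Prop :=
  Λ.rank = (n : ℤ) ∧ Λ'.rank = (n' : ℤ) ∧
    Prec (transposeFun (upsFun Λ'.B)) (transposeFun (upsFun Λ.A)) ∧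
    Prec (transposeFun (upsFun Λ.B)) (transposeFun (upsFun Λ'.A)) ∧
    Λ'.defect = -Λ.defect + 1

/-- `(Λ, Λ') ∈ B^−_{n,n'}`. -/
def BMinus (n n' : ℕ) (Λ Λ' : Symbol) : Prop :=
  Λ.rank = (n : ℤ) ∧ Λ'.rank = (n' : ℤ) ∧
    Prec (transposeFun (upsFun Λ'.A)) (transposeFun (upsFun Λ.B)) ∧
    Prec (transposeFun (upsFun Λ.A)) (transposeFun (upsFun Λ'.B)) ∧
    Λ'.defect = -Λ.defect - 1

/-- A symbol is reduced if not both rows contain `0`. -/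
def Reduced (Λ : Symbol) : Prop := ¬ (0 ∈ Λ.A ∧ 0 ∈ Λ.B)


theorem strictMono_fin_add_sub_le {m : ℕ} {e : Fin m → ℕ} (he : StrictMono e) (i k : ℕ)
    (h : i + k < m) : e ⟨i, by omega⟩ + k ≤ e ⟨i + k, h⟩ := by
  induction k with
  | zero => simp
  | succ k ih =>
    have h₁ := ih (by omega)
    have h₂ : e ⟨i + k, by omega⟩ < e ⟨i + (k + 1), h⟩ := he (by simp [Fin.lt_def])
    omega

theorem upsFun_of_card_le {A : Finset ℕ} {i : ℕ} (h : A.card ≤ i) : upsFun A i = 0 := by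
  simp [upsFun, Nat.not_lt.mpr h]

theorem upsFun_add {A : Finset ℕ} {i : ℕ} (h : i < A.card) :
    upsFun A i + (A.card - 1 - i) = A.orderEmbOfFin rfl ⟨A.card - 1 - i, by omega⟩ := by
  have h₁ := strictMono_fin_add_sub_le (A.orderEmbOfFin rfl).strictMono 0 (A.card - 1 - i)
    (by omega)
  simp only [zero_add] at h₁
  have h₂ : upsFun A i =
      A.orderEmbOfFin rfl ⟨A.card - 1 - i, by omega⟩ - (A.card - 1 - i) := by
    simp [upsFun, h, Finset.orderEmbOfFin_apply]
  omega

theorem antitone_upsFun (A : Finset ℕ) : Antitone (upsFun A) := by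
  intro i j hij
  by_cases hj : j < A.card
  · have h₁ := upsFun_add hj
    have h₂ := upsFun_add (hij.trans_lt hj)
    have h₃ := strictMono_fin_add_sub_le (A.orderEmbOfFin rfl).strictMono (A.card - 1 - j) (j - i)
      (by omega)
    have h₄ : A.card - 1 - j + (j - i) = A.card - 1 - i := by omega
    simp only [h₄] at h₃
    omega
  · simp [upsFun_of_card_le (Nat.not_lt.mp hj)]

theorem isPartitionFun_upsFun (A : Finset ℕ) : IsPartitionFun (upsFun A) :=
  ⟨antitone_upsFun A, A.card, fun _ => upsFun_of_card_le⟩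

/-- The set of `m` naturals `f i + (m - 1 - i)`, for `i < m`, attached to a partition `f`. -/
def betaSet (f : ℕ → ℕ) (m : ℕ) : Finset ℕ :=
  (Finset.range m).image fun i => f i + (m - 1 - i)

theorem betaSet_upsFun (A : Finset ℕ) : betaSet (upsFun A) A.card = A := by
  ext a
  simp only [betaSet, Finset.mem_image, Finset.mem_range]
  constructor
  · rintro ⟨i, hi, rfl⟩
    rw [upsFun_add hi]
    exact Finset.orderEmbOfFin_mem _ _ _
  · intro ha
    have h : a ∈ Set.range (A.orderEmbOfFin rfl) := by
      rw [Finset.range_orderEmbOfFin]; exact ha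
    obtain ⟨⟨j, hj⟩, rfl⟩ := h
    refine ⟨A.card - 1 - j, by omega, ?_⟩
    rw [upsFun_add (by omega)]
    congr 2
    omega

theorem insert_zero_betaSet {f : ℕ → ℕ} {m : ℕ} (h : f m = 0) :
    insert 0 ((betaSet f m).image (· + 1)) = betaSet f (m + 1) := by
  simp only [betaSet, Finset.range_add_one, Finset.image_insert, Finset.image_image]
  congr 1
  · simp [h]
  · refine Finset.image_congr fun i hi => ?_
    have : i < m := by simpa using hi
    simp only [Function.comp]
    omega

theorem Symbol.shift_iterate (Λ : Symbol) (k : ℕ) :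
    Symbol.shift^[k] Λ =
      ⟨betaSet (upsFun Λ.A) (Λ.A.card + k), betaSet (upsFun Λ.B) (Λ.B.card + k)⟩ := by
  induction k with
  | zero => simp [betaSet_upsFun]
  | succ k ih =>
    rw [Function.iterate_succ_apply', ih, Symbol.shift]
    simp only [insert_zero_betaSet (upsFun_of_card_le (Nat.le_add_right _ k)), add_assoc]

theorem Symbol.equiv_of_upsFun_eq {Λ M : Symbol} (hA : upsFun Λ.A = upsFun M.A)
    (hB : upsFun Λ.B = upsFun M.B) (hd : Λ.defect = M.defect) : Λ.Equiv M := by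
  refine ⟨M.A.card, Λ.A.card, ?_⟩
  have : Λ.B.card + M.A.card = M.B.card + Λ.A.card := by
    simp only [Symbol.defect] at hd
    omega
  rw [Symbol.shift_iterate, Symbol.shift_iterate, hA, hB, this, add_comm M.A.card]

theorem sum_upsFun_card (A : Finset ℕ) :
    2 * ∑ a ∈ A, (a : ℤ) =
      2 * ∑ i ∈ Finset.range A.card, (upsFun A i : ℤ) + A.card * (A.card - 1) := by
  have hinj : Set.InjOn (fun i => upsFun A i + (A.card - 1 - i)) (Finset.range A.card) := by
    intro i hi j hj hij
    simp only [Finset.coe_range, Set.mem_Iio] at hi hj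
    simp only at hij
    rcases le_total i j with h | h <;> have := antitone_upsFun A h <;> omega
  have hgauss : ∀ m : ℕ, 2 * ∑ i ∈ Finset.range m, (i : ℤ) = m * (m - 1) := by
    intro m
    induction m with
    | zero => simp
    | succ m ih => rw [Finset.sum_range_succ, mul_add, ih]; push_cast; ring
  conv_lhs => rw [← betaSet_upsFun A, betaSet, Finset.sum_image hinj]
  simp only [Nat.cast_add, Finset.sum_add_distrib]
  rw [Finset.sum_range_reflect (fun i => (i : ℤ)) A.card, mul_add, hgauss]

theorem sum_upsFun {A : Finset ℕ} {N : ℕ} (hN : A.card ≤ N) :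
    2 * ∑ a ∈ A, (a : ℤ) =
      2 * ∑ i ∈ Finset.range N, (upsFun A i : ℤ) + A.card * (A.card - 1) := by
  rw [sum_upsFun_card, Finset.sum_subset (Finset.range_subset_range.mpr hN)]
  intro i _ hi
  simp [upsFun_of_card_le (by simpa using hi : A.card ≤ i)]

theorem Symbol.four_mul_rank {Λ : Symbol} {N : ℕ} (hA : Λ.A.card ≤ N) (hB : Λ.B.card ≤ N) :
    4 * Λ.rank = 4 * (∑ i ∈ Finset.range N, (upsFun Λ.A i : ℤ) +
      ∑ i ∈ Finset.range N, (upsFun Λ.B i : ℤ)) + Λ.defect ^ 2 - Λ.defect % 2 := by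
  have h₁ := sum_upsFun hA
  have h₂ := sum_upsFun hB
  simp only [Symbol.rank, Symbol.defect]
  generalize (Λ.A.card : ℤ) = a at *
  generalize (Λ.B.card : ℤ) = b at *
  have h₃ : 4 * ((a + b - 1) ^ 2 / 4) = (a + b - 1) ^ 2 - 1 + (a - b) % 2 := by
    rcases Int.even_or_odd' (a - b) with ⟨k, hk | hk⟩
    · have : (a + b - 1) ^ 2 = 4 * ((b + k) ^ 2 - (b + k)) + 1 := by
        rw [show a = b + 2 * k by omega]; ring
      omega
    · have : (a + b - 1) ^ 2 = 4 * (b + k) ^ 2 := by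
        rw [show a = b + 2 * k + 1 by omega]; ring
      omega
  linear_combination 2 * h₁ + 2 * h₂ - h₃

theorem IsPartitionFun.lt_transposeFun_iff {f : ℕ → ℕ} (hf : IsPartitionFun f) (i j : ℕ) :
    j < transposeFun f i ↔ i + 1 ≤ f j := by
  obtain ⟨hanti, N, hN⟩ := hf
  have hex : ∃ k, f k < i + 1 := ⟨N, by simp [hN N le_rfl]⟩
  have hset : {j | i + 1 ≤ f j} = Set.Iio (Nat.find hex) := by
    ext k
    simp only [Set.mem_ofPred_eq, Set.mem_Iio, Nat.lt_find_iff, not_lt]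
    exact ⟨fun h l hl => h.trans (hanti hl), fun h => h k le_rfl⟩
  have hcard : transposeFun f i = Nat.find hex := by
    rw [transposeFun, hset, ← Finset.coe_Iio, Set.ncard_coe_finset, Nat.card_Iio]
  rw [hcard, ← Set.mem_Iio, ← hset, Set.mem_ofPred_eq]

theorem Prec.le_of_transposeFun {f g : ℕ → ℕ} (hf : IsPartitionFun f) (hg : IsPartitionFun g)
    (h : Prec (transposeFun f) (transposeFun g)) : f ≤ g := by
  intro j
  by_contra! hlt
  have h₁ := (hf.lt_transposeFun_iff (g j) j).mpr hlt
  have h₂ := (hg.lt_transposeFun_iff (g j) j).mp (h₁.trans_le (h _).2)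
  omega

theorem Prec.tailPart_le_of_transposeFun {f g : ℕ → ℕ} (hf : IsPartitionFun f)
    (hg : IsPartitionFun g) (h : Prec (transposeFun f) (transposeFun g)) : tailPart g ≤ f := by
  intro j
  by_contra! hlt
  have h₁ := (hg.lt_transposeFun_iff (f j) (j + 1)).mpr hlt
  have h₂ := (hf.lt_transposeFun_iff (f j) j).mp (by have := (h (f j)).1; omega)
  omega

theorem BPlus.upsFun_eq {Λ Λ' : Symbol} (hodd : Odd Λ.defect) {n n' : ℕ}
    (hn' : (n' : ℤ) = (n : ℤ) - (upsFun Λ.A 0 : ℤ) - (Λ.defect - 1) / 2)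
    (h : BPlus n n' Λ Λ') :
    upsFun Λ'.A = upsFun Λ.B ∧ upsFun Λ'.B = tailPart (upsFun Λ.A) := by
  obtain ⟨hrank, hrank', hprecA, hprecB, hdef⟩ := h
  have hleA := Prec.le_of_transposeFun (isPartitionFun_upsFun _) (isPartitionFun_upsFun _) hprecB
  have hleB := Prec.tailPart_le_of_transposeFun (isPartitionFun_upsFun _)
    (isPartitionFun_upsFun _) hprecA
  have hsum : ∀ N, Λ.A.card ≤ N → Λ.B.card ≤ N → Λ'.A.card ≤ N → Λ'.B.card ≤ N →
      ∑ i ∈ Finset.range N, (upsFun Λ.B i + tailPart (upsFun Λ.A) i) =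
        ∑ i ∈ Finset.range N, (upsFun Λ'.A i + upsFun Λ'.B i) := by
    intro N h₁ h₂ h₃ h₄
    have hr := Symbol.four_mul_rank h₁ h₂
    have hr' := Symbol.four_mul_rank h₃ h₄
    have htail : ∑ i ∈ Finset.range N, (upsFun Λ.A i : ℤ) =
        ∑ i ∈ Finset.range N, (tailPart (upsFun Λ.A) i : ℤ) + upsFun Λ.A 0 := by
      have hz : (upsFun Λ.A N : ℤ) = 0 := by simp [upsFun_of_card_le h₁]
      rw [← add_zero (∑ i ∈ Finset.range N, (upsFun Λ.A i : ℤ)), ← hz,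
        ← Finset.sum_range_succ, Finset.sum_range_succ']
      rfl
    obtain ⟨k, hk⟩ := hodd
    have hmod : Λ.defect % 2 = 1 := by omega
    have hmod' : Λ'.defect % 2 = 0 := by omega
    have hdiv : (Λ.defect - 1) / 2 = k := by omega
    have hd' : Λ'.defect = -2 * k := by omega
    rw [hrank, htail, hmod, hk] at hr
    rw [hrank', hmod', hd', hn', hdiv] at hr'
    have hsumℤ : ((∑ i ∈ Finset.range N, (upsFun Λ.B i + tailPart (upsFun Λ.A) i) : ℕ) : ℤ) =
        (∑ i ∈ Finset.range N, (upsFun Λ'.A i + upsFun Λ'.B i) : ℕ) := by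
      push_cast
      rw [Finset.sum_add_distrib, Finset.sum_add_distrib]
      refine mul_left_cancel₀ (four_ne_zero (α := ℤ)) ?_
      linear_combination hr' - hr
    exact_mod_cast hsumℤ
  have hpoint (i : ℕ) : upsFun Λ.B i + tailPart (upsFun Λ.A) i =
      upsFun Λ'.A i + upsFun Λ'.B i := by
    have hs := hsum (Λ.A.card + Λ.B.card + Λ'.A.card + Λ'.B.card + (i + 1))
      (by omega) (by omega) (by omega) (by omega)
    exact (Finset.sum_eq_sum_iff_of_le fun j _ => add_le_add (hleA j) (hleB j)).mp hs i
      (Finset.mem_range.mpr (by omega))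
  constructor <;> ext i <;> have h₁ := hpoint i <;> have h₂ := hleA i <;> have h₃ := hleB i <;>
    simp only at h₁ h₂ h₃ <;> omega

/-- For a symbol `Λ` of odd defect, rank `n`, `Υ(Λ) = [λ; μ]` and
`n' = n − λ_1 − (def(Λ)−1)/2`: any `Λ'` with `(Λ, Λ') ∈ B^+_{n,n'}` satisfies
`Υ(Λ')^* = μ`, `Υ(Λ')_* = λ²` and `def(Λ') = −def(Λ)+1`; in particular any two
such `Λ'` are equivalent. -/
theorem statement8 (Λ : Symbol) (hodd : Odd Λ.defect) (n n' : ℕ) (hn : Λ.rank = (n : ℤ))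
    (hn' : (n' : ℤ) = (n : ℤ) - (upsFun Λ.A 0 : ℤ) - (Λ.defect - 1) / 2) :
    (∀ Λ' : Symbol, BPlus n n' Λ Λ' →
      upsFun Λ'.A = upsFun Λ.B ∧ upsFun Λ'.B = tailPart (upsFun Λ.A) ∧
      Λ'.defect = -Λ.defect + 1) ∧
    (∀ Λ' Λ'' : Symbol, BPlus n n' Λ Λ' → BPlus n n' Λ Λ'' → Symbol.Equiv Λ' Λ'') := by
  refine ⟨fun Λ' h => ?_, fun Λ' Λ'' h h' => ?_⟩
  · obtain ⟨hA, hB⟩ := h.upsFun_eq hodd hn'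
    exact ⟨hA, hB, h.2.2.2.2⟩
  · obtain ⟨hA, hB⟩ := h.upsFun_eq hodd hn'
    obtain ⟨hA', hB'⟩ := h'.upsFun_eq hodd hn'
    exact Symbol.equiv_of_upsFun_eq (hA.trans hA'.symm) (hB.trans hB'.symm)
      (h.2.2.2.2.trans h'.2.2.2.2.symm)

end GGP
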